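/- Assume n is at least the number of rows of λ. In the expansion of Φ_1(T_λ) in the basis {e_i ⊗ T : 1 ≤ i ≤ n, T ∈ 𝒯_{λ∖X,n}} of V ⊗ ℱ_{λ∖X,n}, the coefficient of e_α ⊗ T_{λ∖X} equals −w_{b_1}, where α = ∑_{i=b_1}^{N} h_i (the top-indexed row number of the removed box x_1) and T_{λ∖X} is the highest-weight tableau of shape λ∖X. -/

import Mathlib

/-!
Formalization of definitions from "Pieri inclusions" (arXiv:1911.11045).

Cells `(r, j)` have row index `r` (counted from the *top*, `0`-based; so a cell is
geometrically *lower* than another iff its row index is *larger*) and column index `j`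
(`0`-based).  A shape is a finite set `K` of cells; in the intended applications `K` is the
set of cells of a Young diagram (possibly with some boxes removed).  Blocks of a partition
are recovered as the (automatically contiguous) groups of rows of equal width.
-/

open scoped TensorProduct Classical

noncomputable section

namespace PieriPaper

/-! ### Shapes, tableaux, Garnir relations -/

/-- A cell `(r, j)`: row `r` (from the top, `0`-based), column `j` (`0`-based). -/
abbrev Cell : Type := ℕ × ℕ

/-- The boxes of the shape given by a finite set `K` of cells. -/
abbrev BoxOf (K : Finset Cell) : Type := {c : Cell // c ∈ K}

/-- Tableaux of shape `K` with entries in `Fin n` (representing `{1, …, n}`). -/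
abbrev Tab (K : Finset Cell) (n : ℕ) : Type := BoxOf K → Fin n

/-- `ℱ_{K,n}`: the free complex vector space on the set of tableaux of shape `K`. -/
abbrev FreeT (K : Finset Cell) (n : ℕ) : Type := Tab K n →₀ ℂ

/-- The number of boxes of `K` in row `r` (the width of row `r`). -/
def rowWidth (K : Finset Cell) (r : ℕ) : ℕ := (K.filter fun c => c.1 = r).card

/-- The set of indices of nonempty rows of `K`. -/
def rowsOf (K : Finset Cell) : Finset ℕ := K.image Prod.fst

/-- The set of boxes of `K` lying in row `r`. -/
def rowBoxes (K : Finset Cell) (r : ℕ) : Finset (BoxOf K) :=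
  Finset.univ.filter fun b => b.val.1 = r

/-- Action of a permutation of the boxes on tableaux: `(σ · T) x = T (σ⁻¹ x)`. -/
def permAct {K : Finset Cell} {n : ℕ} (σ : Equiv.Perm (BoxOf K)) (T : Tab K n) : Tab K n :=
  fun x => T (σ⁻¹ x)

/-- The linear extension of the permutation action to `ℱ_{K,n}`. -/
def permL (K : Finset Cell) (n : ℕ) (σ : Equiv.Perm (BoxOf K)) : FreeT K n →ₗ[ℂ] FreeT K n :=
  Finsupp.lift (FreeT K n) ℂ (Tab K n) fun T => Finsupp.single (permAct σ T) 1

/-- `w_A`: the maximum width of a row meeting `A`. -/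
def wA (K : Finset Cell) (A : Finset (BoxOf K)) : ℕ := A.sup fun x => rowWidth K x.val.1

/-- `𝔖_A`: permutations preserving `A` and fixing every box outside `A`. -/
def SA {K : Finset Cell} (A : Finset (BoxOf K)) : Finset (Equiv.Perm (BoxOf K)) :=
  Finset.univ.filter fun σ => ∀ x, x ∉ A → σ x = x

/-- The Garnir operator `G_A` applied to a tableau `T`. -/
def garnir {K : Finset Cell} {n : ℕ} (A : Finset (BoxOf K)) (T : Tab K n) : FreeT K n :=
  ∑ σ ∈ SA A, Finsupp.single (permAct σ T) 1

/-- The linear extension of the Garnir operator `G_A` to `ℱ_{K,n}`. -/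
def garnirL (K : Finset Cell) (n : ℕ) (A : Finset (BoxOf K)) : FreeT K n →ₗ[ℂ] FreeT K n :=
  Finsupp.lift (FreeT K n) ℂ (Tab K n) fun T => garnir A T

/-- Two tableaux agree up to permutations of the entries within rows. -/
def RowEquiv {K : Finset Cell} {n : ℕ} (T₁ T₂ : Tab K n) : Prop :=
  ∃ σ : Equiv.Perm (BoxOf K), (∀ x, (σ x).val.1 = x.val.1) ∧ T₂ = permAct σ T₁

/-- The span of the row-permutation differences `T₁ - T₂`. -/
def rowSpan (K : Finset Cell) (n : ℕ) : Submodule ℂ (FreeT K n) :=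
  Submodule.span ℂ
    {z | ∃ T₁ T₂ : Tab K n, RowEquiv T₁ T₂ ∧ z = Finsupp.single T₁ 1 - Finsupp.single T₂ 1}

/-- `R_{K,n}`: the subspace of relations, spanned by row-permutation differences and
Garnir elements `G_A T` for `|A| > w_A`. -/
def Rmod (K : Finset Cell) (n : ℕ) : Submodule ℂ (FreeT K n) :=
  Submodule.span ℂ
    ({z | ∃ T₁ T₂ : Tab K n, RowEquiv T₁ T₂ ∧ z = Finsupp.single T₁ 1 - Finsupp.single T₂ 1} ∪
      {z | ∃ (A : Finset (BoxOf K)) (T : Tab K n), wA K A < A.card ∧ z = garnir A T})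

/-- The standard basis vector `e_i` of `V = ℂⁿ`. -/
def stdv (n : ℕ) (i : Fin n) : Fin n → ℂ := Pi.single i 1

/-- The action of a matrix `g` on `ℱ_{K,n}`:
`g · T = ∑_{T'} (∏_x g_{T'(x), T(x)}) T'`. -/
def glAct (K : Finset Cell) (n : ℕ) (g : Matrix (Fin n) (Fin n) ℂ) :
    FreeT K n →ₗ[ℂ] FreeT K n :=
  Finsupp.lift (FreeT K n) ℂ (Tab K n) fun T =>
    ∑ T' : Tab K n, (∏ x : BoxOf K, g (T' x) (T x)) • Finsupp.single T' (1 : ℂ)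

/-! ### Removal sets -/

/-- A removal set of `m` boxes `x_1 < x_2 < ⋯ < x_m` for the shape `K`: each `x_k` is the
rightmost box of its row, `x_1` is geometrically lowest (largest top-row-index), … , `x_m`
highest, and removing all of them leaves a Young-diagram shape (a lower set). -/
structure RemovalOn (K : Finset Cell) (m : ℕ) where
  box : Fin m → Cell
  mem : ∀ k, box k ∈ K
  lastCol : ∀ k, (box k).2 + 1 = rowWidth K (box k).1
  rows_anti : StrictAnti fun k => (box k).1
  lower : IsLowerSet (↑(K.filter fun c => ∀ i : Fin m, (i : ℕ) < m → c ≠ box i) : Set Cell)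

/-- The shape obtained from `K` by removing the first `k` boxes `x_1, …, x_k` of `X`. -/
def keptUpTo {K : Finset Cell} {m : ℕ} (X : RemovalOn K m) (k : ℕ) : Finset Cell :=
  K.filter fun c => ∀ i : Fin m, (i : ℕ) < k → c ≠ X.box i

/-- `λ ∖ X`: the shape obtained by removing all the boxes of `X`. -/
abbrev RemovalOn.kept {K : Finset Cell} {m : ℕ} (X : RemovalOn K m) : Finset Cell := keptUpTo X m

lemma keptUpTo_subset {K : Finset Cell} {m : ℕ} (X : RemovalOn K m) (k : ℕ) :
    keptUpTo X k ⊆ K := Finset.filter_subset _ _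

lemma kept_subset {K : Finset Cell} {m : ℕ} (X : RemovalOn K m) : X.kept ⊆ K :=
  Finset.filter_subset _ _

lemma keptUpTo_zero {K : Finset Cell} {m : ℕ} (X : RemovalOn K m) : K = keptUpTo X 0 :=
  (Finset.filter_true_of_mem fun _ _ => fun _ hi => absurd hi (Nat.not_lt_zero _)).symm

/-! ### Paths -/

/-- The boxes of `K` together with `m` extra boxes `y_1, …, y_m` attached above the shape. -/
abbrev PB (K : Finset Cell) (m : ℕ) : Type := BoxOf K ⊕ Fin m

/-- Comparison value of a box: a box is geometrically weakly lower than another iff its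
`lowVal` is larger.  The extra boxes `y_1, y_2, …` get values `-1, -2, …` (above the shape,
with `y_{i+1}` above `y_i`). -/
def lowVal {K : Finset Cell} {m : ℕ} : PB K m → ℤ
  | Sum.inl b => (b.val.1 : ℤ)
  | Sum.inr i => -1 - (i : ℤ)

/-- An evacuation route starting at the block whose bottom row is `r₁`: it contains a box in
row `r₁`, at most one box per row, and skips no row within a block (blocks being the groups
of rows of equal width). -/
structure IsEvacRoute (K : Finset Cell) (r₁ : ℕ) (R : Finset (BoxOf K)) : Prop where
  start : ∃ b ∈ R, b.val.1 = r₁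
  one_per_row : ∀ b ∈ R, ∀ b' ∈ R, b.val.1 = b'.val.1 → b = b'
  no_skip : ∀ b ∈ R, ∀ r' : ℕ, b.val.1 < r' → rowWidth K r' = rowWidth K b.val.1 →
    ∃ b' ∈ R, b'.val.1 = r'

/-- The orbit `R_i` of `x_i` under iteration of `P`. -/
def orb {K : Finset Cell} {m : ℕ} (X : RemovalOn K m) (P : PB K m → PB K m) (i : Fin m) :
    Set (PB K m) := {z | ∃ j : ℕ, P^[j] (Sum.inl ⟨X.box i, X.mem i⟩) = z}

/-- The orbit of `x_i` meets the block (of the original shape) of width `w`. -/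
def meetsBlock {K : Finset Cell} {m : ℕ} (X : RemovalOn K m) (P : PB K m → PB K m)
    (i : Fin m) (w : ℕ) : Prop :=
  ∃ c : BoxOf K, Sum.inl c ∈ orb X P i ∧ rowWidth K c.val.1 = w

/-- `P` together with the evacuation route `R` is an `m`-path removing `X`:
see Section 4.2 of the paper. -/
structure IsMPath {K : Finset Cell} {m : ℕ} [NeZero m] (X : RemovalOn K m)
    (P : PB K m → PB K m) (R : Finset (BoxOf K)) : Prop where
  /-- the route starts at the block of `x₁` -/
  route : IsEvacRoute K (X.box 0).1 R
  /-- `P` is geometrically (weakly) increasing -/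
  mono : ∀ z, lowVal (P z) ≤ lowVal z
  /-- and strictly increasing on the route -/
  strict_on_route : ∀ b ∈ R, lowVal (P (Sum.inl b)) < (b.val.1 : ℤ)
  /-- `y_i` belongs to the orbit of `x_i` -/
  y_mem : ∀ i, Sum.inr i ∈ orb X P i
  /-- `R ∪ X ∪ Y` is the union of the orbits -/
  orb_union : (⋃ i, orb X P i) =
    {z : PB K m | (∃ b ∈ R, z = Sum.inl b) ∨ (∃ i, z = Sum.inl ⟨X.box i, X.mem i⟩) ∨
      ∃ i, z = Sum.inr i}
  /-- and the union is disjoint -/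
  orb_disjoint : ∀ i j, i ≠ j → Disjoint (orb X P i) (orb X P j)
  /-- if `k` distinct orbits meet a block, then (up to relabeling) the `j`-th of them meets
  the `j`-th row from the bottom of the block, for `j = 0, …, k-1` -/
  interlace : ∀ w : ℕ, 0 < w → ∃ g : Fin m → ℕ,
    Set.InjOn g {i | meetsBlock X P i w} ∧
    ∀ i, meetsBlock X P i w →
      g i < Set.ncard {j | meetsBlock X P j w} ∧
      ∃ c : BoxOf K, Sum.inl c ∈ orb X P i ∧ rowWidth K c.val.1 = w ∧
        ((rowsOf K).filter fun r => c.val.1 < r ∧ rowWidth K r = w).card = g i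
  /-- `P` preserves row order within blocks on the route -/
  row_order : ∀ b ∈ R, ∀ b' ∈ R, ∀ c c' : BoxOf K,
    rowWidth K b.val.1 = rowWidth K b'.val.1 → b'.val.1 < b.val.1 →
    P (Sum.inl b) = Sum.inl c → P (Sum.inl b') = Sum.inl c' →
    rowWidth K c.val.1 = rowWidth K b.val.1 → rowWidth K c'.val.1 = rowWidth K b.val.1 →
    c'.val.1 < c.val.1
  /-- `P` fixes the extra boxes -/
  fix_y : ∀ i, P (Sum.inr i) = Sum.inr i
  /-- `P` fixes every box outside `R ∪ X` -/
  fix_out : ∀ b : BoxOf K, b ∉ R → (∀ i, b.val ≠ X.box i) → P (Sum.inl b) = Sum.inl b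
  /-- `P(R ∪ X) = (R ∖ X) ∪ Y` -/
  image_route : (fun b : BoxOf K => P (Sum.inl b)) ''
      {b : BoxOf K | b ∈ R ∨ ∃ i, b.val = X.box i} =
    (Sum.inl '' {b : BoxOf K | b ∈ R ∧ ∀ i, b.val ≠ X.box i}) ∪
      Set.range (Sum.inr : Fin m → PB K m)

/-- The type of `m`-paths removing `X` (a path is the pair of the map and its route). -/
def MPath {K : Finset Cell} {m : ℕ} [NeZero m] (X : RemovalOn K m) : Type :=
  {PR : (PB K m → PB K m) × Finset (BoxOf K) // IsMPath X PR.1 PR.2}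

instance {K : Finset Cell} {m : ℕ} [NeZero m] (X : RemovalOn K m) : Fintype (MPath X) := by
  unfold MPath; infer_instance

/-- The underlying map of boxes of a path. -/
def MPath.map {K : Finset Cell} {m : ℕ} [NeZero m] {X : RemovalOn K m} (P : MPath X) :
    PB K m → PB K m := P.val.1

/-- The evacuation route of a path. -/
def MPath.route {K : Finset Cell} {m : ℕ} [NeZero m] {X : RemovalOn K m} (P : MPath X) :
    Finset (BoxOf K) := P.val.2

/-- `P⁻¹ z`: the (unique) box of the original shape whose image under `P` is `z`. -/
def pinv {K : Finset Cell} {m : ℕ} [NeZero m] (X : RemovalOn K m) (P : PB K m → PB K m)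
    (z : PB K m) : BoxOf K :=
  @Function.invFun (BoxOf K) (PB K m) ⟨⟨X.box 0, X.mem 0⟩⟩ (fun b => P (Sum.inl b)) z

/-- `α_i^P`: the entry of `T` in the box `P⁻¹ (y_i)`. -/
def alphaP {K : Finset Cell} {m n : ℕ} [NeZero m] (X : RemovalOn K m) (T : Tab K n)
    (P : PB K m → PB K m) (i : Fin m) : Fin n := T (pinv X P (Sum.inr i))

/-- `T_P`: the tableau of shape `λ ∖ X` with `(T_P)_z = T_{P⁻¹ z}`. -/
def TP {K : Finset Cell} {m n : ℕ} [NeZero m] (X : RemovalOn K m) (T : Tab K n)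
    (P : PB K m → PB K m) : Tab X.kept n :=
  fun z => T (pinv X P (Sum.inl ⟨z.val, kept_subset X z.2⟩))

/-! ### Hook lengths and coefficients -/

/-- `H(b)` for the block `b` of width `w`, relative to the starting row `r₁`:
`H(b) = (w_b - w_{b₁}) + (number of rows in blocks b₁, …, b-1)`. -/
def HW (K : Finset Cell) (r₁ w : ℕ) : ℤ :=
  ((w : ℤ) - (rowWidth K r₁ : ℤ)) +
    (((rowsOf K).filter fun ρ => rowWidth K r₁ ≤ rowWidth K ρ ∧ rowWidth K ρ < w).card : ℤ)

/-- `H(P)` for a `1`-path with route `R`: the product of `H(b)` over the blocks `b > b₁`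
met by the route. -/
def HP1 (K : Finset Cell) (r₁ : ℕ) (R : Finset (BoxOf K)) : ℤ :=
  ∏ w ∈ (R.image fun b => rowWidth K b.val.1).filter (fun w => rowWidth K r₁ < w), HW K r₁ w

/-- The rank (from the bottom, `1`-based) of a route box among the route boxes lying in the
same block. -/
def rankIn (K : Finset Cell) (R : Finset (BoxOf K)) (b : BoxOf K) : ℕ :=
  (R.filter fun b' => rowWidth K b'.val.1 = rowWidth K b.val.1 ∧ b.val.1 ≤ b'.val.1).card

/-- `H(P)` for an `m`-path with route `R`:
`H(P) = ∏_{b > b₁ met by R} ∏_{i=1}^{k_b} (H(b) - (m - i))`. -/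
def HPm (K : Finset Cell) (m : ℕ) (r₁ : ℕ) (R : Finset (BoxOf K)) : ℤ :=
  ∏ b ∈ R.filter fun b => rowWidth K r₁ < rowWidth K b.val.1,
    (HW K r₁ (rowWidth K b.val.1) - (m : ℤ) + (rankIn K R b : ℤ))

/-- The coefficient `(-1)^P / H(P)` of a `1`-path. -/
def coeff1 (K : Finset Cell) (r₁ : ℕ) (R : Finset (BoxOf K)) : ℂ :=
  (-1 : ℂ) ^ R.card / ((HP1 K r₁ R : ℤ) : ℂ)

/-- The coefficient `(-1)^P / H(P)` of an `m`-path. -/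
def coeffm (K : Finset Cell) (m r₁ : ℕ) (R : Finset (BoxOf K)) : ℂ :=
  (-1 : ℂ) ^ R.card / ((HPm K m r₁ R : ℤ) : ℂ)

/-- The subspace `W ⊗ R_{K,n}` of `W ⊗ ℱ_{K,n}`. -/
def tensR (W : Type) [AddCommGroup W] [Module ℂ W] (K : Finset Cell) (n : ℕ) :
    Submodule ℂ (W ⊗[ℂ] FreeT K n) :=
  Submodule.span ℂ {z | ∃ (a : W) (r : FreeT K n), r ∈ Rmod K n ∧ z = a ⊗ₜ[ℂ] r}

/-! ### Path extensions -/

/-- `B` is a `(ρ, ρ')`-route extension of `R`, where `ρ` is the (geometrically lower) row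
with top-index `rlow` and `ρ'` the (higher) row with top-index `rhigh ≤ rlow`: the two
routes agree strictly below `ρ` and strictly above `ρ'`. -/
def RouteExt {K : Finset Cell} (rlow rhigh : ℕ) (R B : Finset (BoxOf K)) : Prop :=
  R.filter (fun b => rlow < b.val.1) = B.filter (fun b => rlow < b.val.1) ∧
  R.filter (fun b => b.val.1 < rhigh) = B.filter (fun b => b.val.1 < rhigh)

/-- `Q` is a `(ρ, ρ')`-path extension of `P` (rows as in `RouteExt`). -/
def PathExt {K : Finset Cell} {m : ℕ} [NeZero m] {X : RemovalOn K m} (rlow rhigh : ℕ)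
    (P Q : MPath X) : Prop :=
  RouteExt rlow rhigh P.route Q.route ∧
  (∀ b ∈ P.route, b.val.1 < rhigh → Q.map (Sum.inl b) = P.map (Sum.inl b)) ∧
  (∀ b ∈ P.route, rlow < b.val.1 →
    ¬(∃ c : BoxOf K, P.map (Sum.inl b) = Sum.inl c ∧ rhigh ≤ c.val.1 ∧ c.val.1 ≤ rlow) →
    Q.map (Sum.inl b) = P.map (Sum.inl b))

/-! ### The Pieri inclusion removing one box -/

/-- `P(T) = e_{α₁^P} ⊗ T_P` for a `1`-path. -/
def pact1 {K : Finset Cell} {n : ℕ} (X : RemovalOn K 1) (T : Tab K n)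
    (P : PB K 1 → PB K 1) : (Fin n → ℂ) ⊗[ℂ] FreeT X.kept n :=
  stdv n (alphaP X T P 0) ⊗ₜ[ℂ] Finsupp.single (TP X T P) 1

/-- The Pieri inclusion `Φ₁ : ℱ_{λ,n} → V ⊗ ℱ_{λ∖X,n}`,
`Φ₁ T = ∑_P ((-1)^P / H(P)) P(T)`, the sum over all `1`-paths removing `X`. -/
def Phi1 {K : Finset Cell} (X : RemovalOn K 1) (n : ℕ) :
    FreeT K n →ₗ[ℂ] ((Fin n → ℂ) ⊗[ℂ] FreeT X.kept n) :=
  Finsupp.lift ((Fin n → ℂ) ⊗[ℂ] FreeT X.kept n) ℂ (Tab K n) fun T =>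
    ∑ P : MPath X, coeff1 K (X.box 0).1 P.route • pact1 X T P.map

/-! ### Highest weight tableaux and coefficient extraction -/

/-- The highest-weight tableau: every entry in row `r` (from the top, `0`-based) equals
`r + 1` (i.e. the element `r` of `Fin n`). -/
def hwTab (K : Finset Cell) (n : ℕ) (hn : ∀ c ∈ K, c.1 < n) : Tab K n :=
  fun b => ⟨b.val.1, hn _ b.2⟩

/-- The coefficient of the basis vector `e_i ⊗ T₀` of `V ⊗ ℱ_{K',n}`. -/
def coeffAt {K' : Finset Cell} {n : ℕ} (i : Fin n) (T0 : Tab K' n) :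
    ((Fin n → ℂ) ⊗[ℂ] FreeT K' n) →ₗ[ℂ] ℂ :=
  TensorProduct.lift
    (((LinearMap.mul ℂ ℂ).comp (LinearMap.proj i)).compl₂ (Finsupp.lapply T0))

/-- The set of rows met by a route. -/
def rowsMet {K : Finset Cell} (R : Finset (BoxOf K)) : Finset ℕ := R.image fun b => b.val.1

/-! ### The paths contributing to the highest-weight coefficient -/

lemma rowWidth_cells (μ : YoungDiagram) (r : ℕ) : rowWidth μ.cells r = μ.rowLen r := by
  rw [YoungDiagram.rowLen_eq_card]; rfl

/-- The row of the removed box is the lowest row of its block. -/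
lemma rowWidth_ne_of_lt (μ : YoungDiagram) (X : RemovalOn μ.cells 1) {r : ℕ}
    (hr : (X.box 0).1 < r) : rowWidth μ.cells r ≠ rowWidth μ.cells (X.box 0).1 := by
  intro h
  have hlast := X.lastCol 0
  rw [← h, rowWidth_cells] at hlast
  have hmem : (r, (X.box 0).2) ∈ μ := YoungDiagram.mem_iff_lt_rowLen.2 (by omega)
  have hkept : (r, (X.box 0).2) ∈ (↑(μ.cells.filter fun c =>
      ∀ i : Fin 1, (i : ℕ) < 1 → c ≠ X.box i) : Set Cell) := by
    simp only [Finset.coe_filter, Set.mem_ofPred_eq]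
    refine ⟨hmem, fun i _ heq => ?_⟩
    rw [Subsingleton.elim i 0] at heq
    have := congrArg Prod.fst heq
    simp only at this
    omega
  have hbox := X.lower (show X.box 0 ≤ (r, (X.box 0).2) from ⟨hr.le, le_rfl⟩) hkept
  simp only [Finset.coe_filter, Set.mem_ofPred_eq] at hbox
  exact hbox.2 0 (by simp) rfl

section RowPath

variable {K : Finset Cell} (X : RemovalOn K 1)

/-- The removed box, as a box of the shape. -/
def removedBox : BoxOf K := ⟨X.box 0, X.mem 0⟩

/-- The map sending `b` to the extra box and the removed box (if it is not `b`) to `b`. -/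
def rowPathMap (b : BoxOf K) (z : PB K 1) : PB K 1 :=
  if z = Sum.inl b then Sum.inr 0 else if z = Sum.inl (removedBox X) then Sum.inl b else z

lemma rowPathMap_self (b : BoxOf K) : rowPathMap X b (Sum.inl b) = Sum.inr 0 := by
  simp [rowPathMap]

lemma rowPathMap_removedBox {b : BoxOf K} (hb : b ≠ removedBox X) :
    rowPathMap X b (Sum.inl (removedBox X)) = Sum.inl b := by
  simp [rowPathMap, hb.symm]

lemma rowPathMap_inr (b : BoxOf K) (i : Fin 1) : rowPathMap X b (Sum.inr i) = Sum.inr i := by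
  simp [rowPathMap]

lemma rowPathMap_of_ne {b c : BoxOf K} (hb : c ≠ b) (hx : c ≠ removedBox X) :
    rowPathMap X b (Sum.inl c) = Sum.inl c := by
  simp [rowPathMap, hb, hx]

lemma orb_rowPathMap (b : BoxOf K) (i : Fin 1) :
    orb X (rowPathMap X b) i = {Sum.inl b, Sum.inl (removedBox X), Sum.inr 0} := by
  obtain rfl := Subsingleton.elim i 0
  have hx : (⟨X.box 0, X.mem 0⟩ : BoxOf K) = removedBox X := rfl
  ext z
  simp only [orb, Set.mem_ofPred_eq, Set.mem_insert_iff, Set.mem_singleton_iff, hx]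
  constructor
  · rintro ⟨j, rfl⟩
    induction j with
    | zero => simp
    | succ j ih =>
      rw [Function.iterate_succ_apply']
      rcases ih with h | h | h <;> rw [h]
      · simp [rowPathMap_self]
      · by_cases hb : b = removedBox X
        · subst hb; simp [rowPathMap_self]
        · simp [rowPathMap_removedBox X hb]
      · simp [rowPathMap_inr]
  · by_cases hb : b = removedBox X
    · subst hb
      rintro (rfl | rfl | rfl)
      · exact ⟨0, rfl⟩
      · exact ⟨0, rfl⟩
      · exact ⟨1, rowPathMap_self X _⟩
    · rintro (rfl | rfl | rfl)
      · exact ⟨1, rowPathMap_removedBox X hb⟩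
      · exact ⟨0, rfl⟩
      · refine ⟨2, ?_⟩
        simp [rowPathMap_removedBox X hb, rowPathMap_self]

/-- Every box in the row of the removed box gives a path, provided that row is the lowest
of its block. -/
lemma isMPath_rowPathMap
    (hX : ∀ r, (X.box 0).1 < r → rowWidth K r ≠ rowWidth K (X.box 0).1)
    {b : BoxOf K} (hb : b.val.1 = (X.box 0).1) : IsMPath X (rowPathMap X b) {b} where
  route :=
    { start := ⟨b, by simp, hb⟩
      one_per_row := by simp
      no_skip := by
        intro c hc r hr hw
        obtain rfl := Finset.mem_singleton.1 hc
        rw [hb] at hr hw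
        exact absurd hw (hX r hr) }
  mono := by
    intro z
    by_cases h : z = Sum.inl b
    · subst h
      rw [rowPathMap_self]
      simp only [lowVal]
      have : (0 : ℤ) ≤ (b.val.1 : ℤ) := Int.natCast_nonneg _
      simp only [Fin.val_zero]
      omega
    · by_cases h' : z = Sum.inl (removedBox X)
      · subst h'
        rw [rowPathMap_removedBox X (fun e => h (by rw [e]))]
        simp [lowVal, hb, removedBox]
      · simp [rowPathMap, h, h']
  strict_on_route := by
    intro c hc
    obtain rfl := Finset.mem_singleton.1 hc
    rw [rowPathMap_self]
    simp only [lowVal, Fin.val_zero]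
    omega
  y_mem := by
    intro i
    rw [orb_rowPathMap, Subsingleton.elim i 0]
    simp
  orb_union := by
    ext z
    simp [orb_rowPathMap, removedBox]
  orb_disjoint := fun i j hij => absurd (Subsingleton.elim i j) hij
  interlace := by
    intro w _
    refine ⟨fun _ => 0, fun i _ j _ _ => Subsingleton.elim i j, fun i hi => ⟨?_, ?_⟩⟩
    · exact (Set.ncard_pos (Set.toFinite _)).2 ⟨i, hi⟩
    · obtain ⟨c, hc, hw⟩ := hi
      refine ⟨c, hc, hw, ?_⟩
      have hrow : c.val.1 = (X.box 0).1 := by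
        rw [orb_rowPathMap] at hc
        simp only [Set.mem_insert_iff, Set.mem_singleton_iff, Sum.inl.injEq, reduceCtorEq,
          or_false] at hc
        rcases hc with rfl | rfl
        · exact hb
        · rfl
      rw [Finset.card_eq_zero, Finset.filter_eq_empty_iff]
      rintro r _ ⟨hr, hwr⟩
      rw [hrow] at hr hw
      exact hX r hr (hwr.trans hw.symm)
  row_order := by
    intro c hc c' hc' _ _ _ hlt
    rw [Finset.mem_singleton.1 hc, Finset.mem_singleton.1 hc'] at hlt
    exact absurd hlt (lt_irrefl _)
  fix_y := rowPathMap_inr X b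
  fix_out := by
    intro c hc hx
    exact rowPathMap_of_ne X (by simpa using hc) fun h => hx 0 (by rw [h]; rfl)
  image_route := by
    have hx : ∀ c : BoxOf K, c.val = X.box 0 ↔ c = removedBox X :=
      fun c => by rw [removedBox, Subtype.ext_iff]
    ext z
    simp only [Finset.mem_singleton, Fin.exists_fin_one, Fin.forall_fin_one, Set.mem_image,
      Set.mem_ofPred_eq, Set.mem_union, Set.mem_range, Ne, hx]
    constructor
    · rintro ⟨c, rfl | rfl, rfl⟩
      · exact Or.inr (rowPathMap_self X c).symm
      · by_cases h : b = removedBox X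
        · subst h; exact Or.inr (rowPathMap_self X _).symm
        · exact Or.inl ⟨b, ⟨rfl, h⟩, (rowPathMap_removedBox X h).symm⟩
    · rintro (⟨c, ⟨rfl, h⟩, rfl⟩ | rfl)
      · exact ⟨removedBox X, Or.inr rfl, rowPathMap_removedBox X h⟩
      · exact ⟨b, Or.inl rfl, rowPathMap_self X b⟩

/-- The path through a single box `b` of the row of the removed box. -/
def rowPath (hX : ∀ r, (X.box 0).1 < r → rowWidth K r ≠ rowWidth K (X.box 0).1)
    (b : {b : BoxOf K // b.val.1 = (X.box 0).1}) : MPath X :=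
  ⟨(rowPathMap X b.val, {b.val}), isMPath_rowPathMap X hX b.2⟩

variable {X}

lemma rowPath_map (hX : ∀ r, (X.box 0).1 < r → rowWidth K r ≠ rowWidth K (X.box 0).1)
    (b : {b : BoxOf K // b.val.1 = (X.box 0).1}) :
    (rowPath X hX b).map = rowPathMap X b.val := rfl

lemma rowPath_route (hX : ∀ r, (X.box 0).1 < r → rowWidth K r ≠ rowWidth K (X.box 0).1)
    (b : {b : BoxOf K // b.val.1 = (X.box 0).1}) :
    (rowPath X hX b).route = {b.val} := rfl

lemma map_pinv {P : PB K 1 → PB K 1} {z : PB K 1} (h : ∃ c : BoxOf K, P (Sum.inl c) = z) :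
    P (Sum.inl (pinv X P z)) = z :=
  @Function.invFun_eq (BoxOf K) (PB K 1) ⟨⟨X.box 0, X.mem 0⟩⟩
    (fun c => P (Sum.inl c)) z h

lemma mem_kept_iff {c : Cell} : c ∈ X.kept ↔ c ∈ K ∧ c ≠ X.box 0 := by
  simp [RemovalOn.kept, keptUpTo]

lemma pinv_rowPathMap_inr (b : BoxOf K) : pinv X (rowPathMap X b) (Sum.inr 0) = b := by
  have h := map_pinv (X := X) ⟨b, rowPathMap_self X b⟩
  by_contra hne
  by_cases hx : pinv X (rowPathMap X b) (Sum.inr 0) = removedBox X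
  · simp [rowPathMap, hx ▸ hne, hx] at h
  · simp [rowPathMap, hne, hx] at h

lemma pinv_rowPathMap_inl {b c : BoxOf K} (hb : b.val.1 = (X.box 0).1)
    (hc : c.val ≠ X.box 0) :
    (pinv X (rowPathMap X b) (Sum.inl c)).val.1 = c.val.1 := by
  have hcx : c ≠ removedBox X := fun h => hc (by rw [h]; rfl)
  have hex : ∃ d : BoxOf K, rowPathMap X b (Sum.inl d) = Sum.inl c := by
    by_cases h : c = b
    · subst h; exact ⟨_, rowPathMap_removedBox X hcx⟩
    · exact ⟨c, rowPathMap_of_ne X h hcx⟩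
  have h := map_pinv (X := X) hex
  generalize pinv X (rowPathMap X b) (Sum.inl c) = d at h
  by_cases hd : d = b
  · simp [rowPathMap, hd] at h
  · by_cases hx : d = removedBox X
    · subst hx
      rw [rowPathMap_removedBox X (Ne.symm hd), Sum.inl.injEq] at h
      rw [← h, hb]; rfl
    · rw [rowPathMap_of_ne X hd hx, Sum.inl.injEq] at h
      rw [h]

/-- A path along which `P⁻¹` preserves rows of kept boxes is one of the maps `rowPathMap`. -/
lemma IsMPath.eq_rowPathMap {P : PB K 1 → PB K 1} {R : Finset (BoxOf K)} (h : IsMPath X P R)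
    (hrow : ∀ c : BoxOf K, c.val ≠ X.box 0 → (pinv X P (Sum.inl c)).val.1 = c.val.1) :
    ∃ b : BoxOf K, b.val.1 = (X.box 0).1 ∧ P = rowPathMap X b ∧ R = {b} := by
  have hx : ∀ c : BoxOf K, c.val = X.box 0 ↔ c = removedBox X :=
    fun c => by rw [removedBox, Subtype.ext_iff]
  have himg := h.image_route
  simp only [Fin.exists_fin_one, Fin.forall_fin_one, Ne, hx] at himg
  have hpre : ∀ c ∈ R, c ≠ removedBox X →
      P (Sum.inl (removedBox X)) = Sum.inl c ∧ removedBox X ∉ R ∧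
        c.val.1 = (X.box 0).1 := by
    intro c hc hcx
    have hmem : (Sum.inl c : PB K 1) ∈
        (Sum.inl '' {b : BoxOf K | b ∈ R ∧ ¬ b = removedBox X}) ∪
          Set.range (Sum.inr : Fin 1 → PB K 1) := Or.inl ⟨c, ⟨hc, hcx⟩, rfl⟩
    rw [← himg] at hmem
    obtain ⟨d, -, hd⟩ := hmem
    have hp := map_pinv (X := X) ⟨d, hd⟩
    have hr := hrow c (mt (hx c).1 hcx)
    generalize pinv X P (Sum.inl c) = e at hp hr
    have heR : e ∉ R := by
      intro he
      have := h.strict_on_route e he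
      rw [hp] at this
      simp only [lowVal, hr, lt_irrefl] at this
    have hex : e = removedBox X := by
      by_contra hne
      have := h.fix_out e heR (by simpa [hx] using hne)
      rw [hp, Sum.inl.injEq] at this
      exact heR (this ▸ hc)
    subst hex
    exact ⟨hp, heR, hr.symm⟩
  obtain ⟨b, hbR, hb⟩ := h.route.start
  have hR : R = {b} := by
    ext c
    rw [Finset.mem_singleton]
    refine ⟨fun hc => ?_, fun hc => hc ▸ hbR⟩
    refine h.route.one_per_row c hc b hbR ?_
    by_cases hcx : c = removedBox X
    · rw [hb, hcx]; rfl
    · rw [(hpre c hc hcx).2.2, hb]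
  have hPb : P (Sum.inl b) = Sum.inr 0 := by
    have hmem : P (Sum.inl b) ∈ (fun b : BoxOf K => P (Sum.inl b)) ''
        {b : BoxOf K | b ∈ R ∨ b = removedBox X} := ⟨b, Or.inl hbR, rfl⟩
    rw [himg] at hmem
    rcases hmem with ⟨c, ⟨hc, -⟩, hPc⟩ | ⟨i, hi⟩
    · rw [hR, Finset.mem_singleton] at hc
      have := h.strict_on_route b hbR
      rw [← hPc, hc] at this
      simp only [lowVal, lt_irrefl] at this
    · rw [← hi, Subsingleton.elim i 0]
  refine ⟨b, hb, ?_, hR⟩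
  funext z
  rcases z with c | i
  · by_cases hcb : c = b
    · rw [hcb, hPb, rowPathMap_self]
    · by_cases hcx : c = removedBox X
      · have hbx : b ≠ removedBox X := fun e => hcb (hcx.trans e.symm)
        rw [hcx, rowPathMap_removedBox X hbx]
        exact (hpre b hbR hbx).1
      · rw [rowPathMap_of_ne X hcb hcx]
        exact h.fix_out c (by simpa [hR] using hcb) (by simpa [hx] using hcx)
  · rw [h.fix_y, rowPathMap_inr]

lemma coeff1_singleton {r : ℕ} {b : BoxOf K} (hb : b.val.1 = r) : coeff1 K r {b} = -1 := by
  have : ({rowWidth K r} : Finset ℕ).filter (fun w => rowWidth K r < w) = ∅ := by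
    simp [Finset.filter_singleton]
  simp [coeff1, HP1, hb, this]

end RowPath

lemma coeffAt_stdv_tmul_single {K : Finset Cell} {n : ℕ} (i j : Fin n) (T T' : Tab K n) :
    coeffAt i T (stdv n j ⊗ₜ[ℂ] Finsupp.single T' 1) = if j = i ∧ T' = T then 1 else 0 := by
  by_cases hj : j = i <;> by_cases hT : T' = T
  · simp [coeffAt, stdv, hj, hT]
  · simp [coeffAt, stdv, hj, hT]
  · simp [coeffAt, stdv, hj, hT, Ne.symm hj]
  · simp [coeffAt, stdv, hj, hT, Ne.symm hj]

lemma card_boxes_in_row (K : Finset Cell) (r : ℕ) :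
    Fintype.card {b : BoxOf K // b.val.1 = r} = rowWidth K r := by
  rw [rowWidth, ← Fintype.card_coe]
  exact Fintype.card_congr
    { toFun := fun b => ⟨b.val.val, Finset.mem_filter.2 ⟨b.val.2, b.2⟩⟩
      invFun := fun c => ⟨⟨c.val, (Finset.mem_filter.1 c.2).1⟩, (Finset.mem_filter.1 c.2).2⟩ }

/-- Assume `n` is at least the number of rows of `λ`.  In the expansion
of `Φ₁(T_λ)` in the basis `{e_i ⊗ T}` of `V ⊗ ℱ_{λ∖X,n}`, the coefficient of
`e_α ⊗ T_{λ∖X}` equals `-w_{b₁}`, where `α` is the (`1`-based) row number of the removed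
box `x₁` counted from the top (so `α - 1 = (X.box 0).1` as an index of `Fin n`),
`T_{λ∖X}` is the highest-weight tableau of shape `λ∖X`, and `w_{b₁}` is the width of the
row of `x₁` in `λ`. -/
theorem statement15 (μ : YoungDiagram) (n : ℕ) (hn : ∀ c ∈ μ.cells, c.1 < n)
    (X : RemovalOn μ.cells 1) :
    coeffAt (⟨(X.box 0).1, hn _ (X.mem 0)⟩ : Fin n)
        (hwTab X.kept n fun c hc => hn c (kept_subset X hc))
        (Phi1 X n (Finsupp.single (hwTab μ.cells n hn) 1)) =
      -(rowWidth μ.cells (X.box 0).1 : ℂ) := by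
  have hX : ∀ r, (X.box 0).1 < r → rowWidth μ.cells r ≠ rowWidth μ.cells (X.box 0).1 :=
    fun r hr => rowWidth_ne_of_lt μ X hr
  simp only [Phi1, Finsupp.lift_apply, zero_smul, Finsupp.sum_single_index, one_smul, map_sum,
    map_smul, pact1, coeffAt_stdv_tmul_single]
  rw [← card_boxes_in_row, ← Finset.card_univ, ← mul_neg_one, ← nsmul_eq_mul,
    ← Finset.sum_const]
  symm
  refine Finset.sum_of_injOn
    (fun b => rowPath X hX b)
    ?_ (fun _ _ => Finset.mem_coe.2 (Finset.mem_univ _)) ?_ ?_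
  · intro b _ c _ hbc
    exact Subtype.ext (Finset.singleton_injective (congrArg (fun Q : MPath X => Q.val.2) hbc))
  · intro P _ hP
    have hbad : ¬ (alphaP X (hwTab μ.cells n hn) P.map 0 = ⟨(X.box 0).1, hn _ (X.mem 0)⟩ ∧
        TP X (hwTab μ.cells n hn) P.map =
          hwTab X.kept n fun c hc => hn c (kept_subset X hc)) := by
      rintro ⟨-, hT⟩
      obtain ⟨b, hb, hmap, hroute⟩ := P.2.eq_rowPathMap fun c hc =>
        congrArg Fin.val (congrFun hT ⟨c.val, mem_kept_iff.2 ⟨c.2, hc⟩⟩)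
      exact hP ⟨⟨b, hb⟩, Finset.mem_coe.2 (Finset.mem_univ _),
        Subtype.ext (Prod.ext hmap.symm hroute.symm)⟩
    rw [if_neg hbad, smul_zero]
  · intro b _
    have hgood : alphaP X (hwTab μ.cells n hn) (rowPathMap X b.val) 0 =
          ⟨(X.box 0).1, hn _ (X.mem 0)⟩ ∧
        TP X (hwTab μ.cells n hn) (rowPathMap X b.val) =
          hwTab X.kept n fun c hc => hn c (kept_subset X hc) := by
      refine ⟨Fin.ext ?_, funext fun c => Fin.ext ?_⟩
      · simp only [alphaP, hwTab, pinv_rowPathMap_inr, b.2]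
      · exact pinv_rowPathMap_inl b.2 (mem_kept_iff.1 c.2).2
    rw [rowPath_map, rowPath_route, coeff1_singleton b.2, if_pos hgood, smul_eq_mul, mul_one]

end PieriPaper
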